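/- arXiv:2307.06831 — 3 statements merged into one kernel-verified Lean document; each statement's English description precedes it below -/
import Mathlib

section
/- Define the set function Q̄ on 𝓕 by Q̄(∅) = 0 and Q̄(A) = (1-ε)·P(A) + ε for every nonempty measurable A. Then Q̄ is concave (2-alternating): for all measurable sets A and B, Q̄(A ∪ B) + Q̄(A ∩ B) ≤ Q̄(A) + Q̄(B). -/
open MeasureTheory Classical
open scoped ENNReal Classical

/-- The upper probability of the ε-contaminated class, `Q̄(∅) = 0` and
`Q̄(A) = (1-ε)·P(A) + ε` for nonempty `A`, is concave (2-alternating):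
`Q̄(A ∪ B) + Q̄(A ∩ B) ≤ Q̄(A) + Q̄(B)` for all measurable `A`, `B`. -/
theorem eps_contaminated_upper_prob_concave
    {Ω : Type*} [MeasurableSpace Ω]
    (P : Measure Ω) [IsProbabilityMeasure P]
    (ε : ℝ≥0∞) (hε : ε ≤ 1)
    (Qbar : Set Ω → ℝ≥0∞)
    (hQbar : ∀ A : Set Ω, Qbar A = if A = ∅ then 0 else (1 - ε) * P A + ε) :
    ∀ A B : Set Ω, MeasurableSet A → MeasurableSet B →
      Qbar (A ∪ B) + Qbar (A ∩ B) ≤ Qbar A + Qbar B := by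
  intro A B hA hB
  have h0 : Qbar ∅ = 0 := by rw [hQbar, if_pos rfl]
  by_cases hAe : A = ∅
  · subst hAe
    rw [Set.empty_union, Set.empty_inter, h0, add_zero, zero_add]
  by_cases hBe : B = ∅
  · subst hBe
    rw [Set.union_empty, Set.inter_empty, h0]
  have hU : A ∪ B ≠ ∅ := fun h => hAe (Set.union_empty_iff.mp h).1
  have hI : Qbar (A ∩ B) ≤ (1 - ε) * P (A ∩ B) + ε := by
    rw [hQbar]
    split_ifs
    · exact zero_le
    · exact le_rfl
  rw [hQbar (A ∪ B), hQbar A, hQbar B, if_neg hU, if_neg hAe, if_neg hBe]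
  calc (1 - ε) * P (A ∪ B) + ε + Qbar (A ∩ B)
      ≤ (1 - ε) * P (A ∪ B) + ε + ((1 - ε) * P (A ∩ B) + ε) := by gcongr
    _ = (1 - ε) * (P (A ∪ B) + P (A ∩ B)) + (ε + ε) := by ring
    _ = (1 - ε) * (P A + P B) + (ε + ε) := by rw [measure_union_add_inter A hB]
    _ = (1 - ε) * P A + ε + ((1 - ε) * P B + ε) := by ring
    _ ≤ _ := le_rfl
end

section
/- Fix a measurable set A ⊆ Θ. Let c := sup_{P∈𝒫} ∫_A L̄ dP + inf_{P∈𝒫} ∫_{Aᶜ} L_ dP, and let c' := ∫_0^∞ sup_{P∈𝒫} P({θ : L̄(θ)·𝟙_A(θ) > t}) dt + ∫_0^∞ inf_{P∈𝒫} P({θ : L_(θ)·𝟙_{Aᶜ}(θ) > t}) dt. Assume c > 0 and c' > 0. Then (sup_{P∈𝒫} ∫_A L̄ dP) / c ≤ (∫_0^∞ sup_{P∈𝒫} P({θ : L̄(θ)·𝟙_A(θ) > t}) dt) / c'. -/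
open MeasureTheory

lemma aux_integrable (g : ℝ → ℝ) (hg : Antitone g) (h0 : ∀ t, 0 ≤ g t) (M : ℝ)
    (hM : ∀ t, M ≤ t → g t = 0) : IntegrableOn g (Set.Ioi 0) := by
  have h1 : IntegrableOn g (Set.Icc 0 (max M 0)) :=
    (hg.antitoneOn _).integrableOn_isCompact isCompact_Icc
  refine h1.of_forall_diff_eq_zero measurableSet_Ioi ?_
  rintro t ⟨ht, ht'⟩
  apply hM
  by_contra h
  push Not at h
  exact ht' ⟨le_of_lt ht, le_trans h.le (le_max_left _ _)⟩

lemma aux_layer {Θ : Type*} [MeasurableSpace Θ] (P : Measure Θ) [IsProbabilityMeasure P]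
    (f : Θ → ℝ) (hf : Measurable f) (h0 : ∀ θ, 0 ≤ f θ) (M : ℝ) (hM : ∀ θ, f θ ≤ M) :
    Integrable f P ∧ ∫ θ, f θ ∂P = ∫ t in Set.Ioi (0 : ℝ), (P {θ | f θ > t}).toReal ∧
    IntegrableOn (fun t => (P {θ | f θ > t}).toReal) (Set.Ioi (0 : ℝ)) := by
  have hi : Integrable f P := by
    refine Integrable.of_bound hf.aestronglyMeasurable M (Filter.Eventually.of_forall fun θ => ?_)
    rw [Real.norm_of_nonneg (h0 θ)]
    exact hM θ
  refine ⟨hi, hi.integral_eq_integral_meas_lt (Filter.Eventually.of_forall h0), ?_⟩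
  refine aux_integrable _ ?_ (fun t => ENNReal.toReal_nonneg) M ?_
  · intro s t hst
    exact measureReal_mono (μ := P) (fun θ (h : f θ > t) => lt_of_le_of_lt hst h)
  · intro t ht
    have : {θ | f θ > t} = ∅ := by
      ext θ
      simpa using (hM θ).trans ht
    simp [this]

lemma aux_main {Θ : Type*} [MeasurableSpace Θ]
    (Ps : Set (Measure Θ)) (hPsne : Ps.Nonempty)
    (hPsprob : ∀ P ∈ Ps, IsProbabilityMeasure P)
    (f : Θ → ℝ) (hf : Measurable f) (h0 : ∀ θ, 0 ≤ f θ) (M : ℝ) (hM : ∀ θ, f θ ≤ M) :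
    sSup {x : ℝ | ∃ P ∈ Ps, x = ∫ θ, f θ ∂P} ≤ (∫ t in Set.Ioi (0 : ℝ),
        sSup {x : ℝ | ∃ P ∈ Ps, x = (P {θ | f θ > t}).toReal}) ∧
    (∫ t in Set.Ioi (0 : ℝ), sInf {x : ℝ | ∃ P ∈ Ps, x = (P {θ | f θ > t}).toReal}) ≤
      sInf {x : ℝ | ∃ P ∈ Ps, x = ∫ θ, f θ ∂P} := by
  have hne : ∀ F : Measure Θ → ℝ, {x : ℝ | ∃ P ∈ Ps, x = F P}.Nonempty := fun F => by
    obtain ⟨P, hP⟩ := hPsne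
    exact ⟨_, P, hP, rfl⟩
  have hba : ∀ t : ℝ, BddAbove {x : ℝ | ∃ P ∈ Ps, x = (P {θ | f θ > t}).toReal} := by
    refine fun t => ⟨1, ?_⟩
    rintro x ⟨P, hP, rfl⟩
    have := hPsprob P hP
    exact measureReal_le_one (μ := P)
  have hbb : ∀ t : ℝ, BddBelow {x : ℝ | ∃ P ∈ Ps, x = (P {θ | f θ > t}).toReal} := by
    refine fun t => ⟨0, ?_⟩
    rintro x ⟨P, hP, rfl⟩
    exact ENNReal.toReal_nonneg
  have hmono : ∀ P ∈ Ps, ∀ s t : ℝ, s ≤ t →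
      (P {θ | f θ > t}).toReal ≤ (P {θ | f θ > s}).toReal := by
    intro P hP s t hst
    have := hPsprob P hP
    exact measureReal_mono (μ := P) (fun θ (h : f θ > t) => lt_of_le_of_lt hst h)
  have hz : ∀ t : ℝ, M ≤ t →
      {x : ℝ | ∃ P ∈ Ps, x = (P {θ | f θ > t}).toReal} = {0} := by
    intro t ht
    have h : {θ | f θ > t} = ∅ := by
      ext θ
      simpa using (hM θ).trans ht
    obtain ⟨P, hP⟩ := hPsne
    ext x
    simp only [h, measure_empty, ENNReal.toReal_zero, Set.mem_setOf_eq, Set.mem_singleton_iff]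
    exact ⟨fun ⟨_, _, h⟩ => h, fun h => ⟨P, hP, h⟩⟩
  have hS : IntegrableOn (fun t => sSup {x : ℝ | ∃ P ∈ Ps, x = (P {θ | f θ > t}).toReal})
      (Set.Ioi (0 : ℝ)) := by
    refine aux_integrable _ ?_ (fun t => Real.sSup_nonneg ?_) M (fun t ht => ?_)
    · intro s t hst
      refine csSup_le (hne _) ?_
      rintro x ⟨P, hP, rfl⟩
      exact (hmono P hP s t hst).trans (le_csSup (hba s) ⟨P, hP, rfl⟩)
    · rintro x ⟨P, hP, rfl⟩
      exact ENNReal.toReal_nonneg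
    · simp only [hz t ht, csSup_singleton]
  have hI : IntegrableOn (fun t => sInf {x : ℝ | ∃ P ∈ Ps, x = (P {θ | f θ > t}).toReal})
      (Set.Ioi (0 : ℝ)) := by
    refine aux_integrable _ ?_ (fun t => Real.sInf_nonneg ?_) M (fun t ht => ?_)
    · intro s t hst
      refine le_csInf (hne _) ?_
      rintro x ⟨P, hP, rfl⟩
      exact (csInf_le (hbb t) ⟨P, hP, rfl⟩).trans (hmono P hP s t hst)
    · rintro x ⟨P, hP, rfl⟩
      exact ENNReal.toReal_nonneg
    · simp only [hz t ht, csInf_singleton]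
  constructor
  · refine csSup_le (hne _) ?_
    rintro x ⟨P, hP, rfl⟩
    have := hPsprob P hP
    obtain ⟨-, h2, h3⟩ := aux_layer P f hf h0 M hM
    rw [h2]
    exact integral_mono h3 hS (fun t => le_csSup (hba t) ⟨P, hP, rfl⟩)
  · refine le_csInf (hne _) ?_
    rintro x ⟨P, hP, rfl⟩
    have := hPsprob P hP
    obtain ⟨-, h2, h3⟩ := aux_layer P f hf h0 M hM
    rw [h2]
    exact integral_mono hI h3 (fun t => csInf_le (hbb t) ⟨P, hP, rfl⟩)

/-- The first (integral-based) upper bound for the posterior is itself bounded by the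
Choquet-integral-based bound: `(sup_{P∈Ps} ∫_A L̄ dP) / c ≤ (∫_0^∞ sup_{P∈Ps} P({L̄·𝟙_A > t}) dt) / c'`,
where `c = sup_{P∈Ps} ∫_A L̄ dP + inf_{P∈Ps} ∫_{Aᶜ} L_ dP > 0` and
`c' = ∫_0^∞ sup_{P∈Ps} P({L̄·𝟙_A > t}) dt + ∫_0^∞ inf_{P∈Ps} P({L_·𝟙_{Aᶜ} > t}) dt > 0`. -/
theorem sup_bound_le_choquet_bound
    {Θ : Type*} [MeasurableSpace Θ]
    (Ps : Set (Measure Θ)) (hPsne : Ps.Nonempty)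
    (hPsprob : ∀ P ∈ Ps, IsProbabilityMeasure P)
    (Ls : Set (Θ → ℝ)) (hLsne : Ls.Nonempty)
    (hLsmeas : ∀ L ∈ Ls, Measurable L)
    (hLsnonneg : ∀ L ∈ Ls, ∀ θ, 0 ≤ L θ)
    (hLsbdd : ∀ L ∈ Ls, ∃ M : ℝ, ∀ θ, L θ ≤ M)
    (Lbar Llow : Θ → ℝ)
    (hLbar : ∀ θ, Lbar θ = sSup {y : ℝ | ∃ L ∈ Ls, y = L θ})
    (hLlow : ∀ θ, Llow θ = sInf {y : ℝ | ∃ L ∈ Ls, y = L θ})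
    (hLbarMeas : Measurable Lbar) (hLlowMeas : Measurable Llow)
    (hLbarBdd : ∃ M : ℝ, ∀ θ, Lbar θ ≤ M)
    (A : Set Θ) (hA : MeasurableSet A)
    (c c' : ℝ)
    (hc : c = sSup {x : ℝ | ∃ P ∈ Ps, x = ∫ θ in A, Lbar θ ∂P}
            + sInf {x : ℝ | ∃ P ∈ Ps, x = ∫ θ in Aᶜ, Llow θ ∂P})
    (hc' : c' = (∫ t in Set.Ioi (0 : ℝ),
                  sSup {x : ℝ | ∃ P ∈ Ps, x = (P {θ | A.indicator Lbar θ > t}).toReal})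
              + ∫ t in Set.Ioi (0 : ℝ),
                  sInf {x : ℝ | ∃ P ∈ Ps, x = (P {θ | Aᶜ.indicator Llow θ > t}).toReal})
    (hcpos : 0 < c) (hc'pos : 0 < c') :
    sSup {x : ℝ | ∃ P ∈ Ps, x = ∫ θ in A, Lbar θ ∂P} / c
      ≤ (∫ t in Set.Ioi (0 : ℝ),
          sSup {x : ℝ | ∃ P ∈ Ps, x = (P {θ | A.indicator Lbar θ > t}).toReal}) / c' := by
  have hbar0 : ∀ θ, 0 ≤ Lbar θ := fun θ => by
    rw [hLbar]
    refine Real.sSup_nonneg ?_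
    rintro x ⟨L, hL, rfl⟩
    exact hLsnonneg L hL θ
  have hlow0 : ∀ θ, 0 ≤ Llow θ := fun θ => by
    rw [hLlow]
    refine Real.sInf_nonneg ?_
    rintro x ⟨L, hL, rfl⟩
    exact hLsnonneg L hL θ
  obtain ⟨M, hM⟩ := hLbarBdd
  obtain ⟨N, hN⟩ : ∃ N : ℝ, ∀ θ, Llow θ ≤ N := by
    obtain ⟨L, hL⟩ := hLsne
    obtain ⟨N, hN⟩ := hLsbdd L hL
    refine ⟨N, fun θ => ?_⟩
    rw [hLlow]
    have hb : BddBelow {y : ℝ | ∃ L ∈ Ls, y = L θ} := by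
      refine ⟨0, ?_⟩
      rintro x ⟨L, hL, rfl⟩
      exact hLsnonneg L hL θ
    have hmem : L θ ∈ {y : ℝ | ∃ L ∈ Ls, y = L θ} := ⟨L, hL, rfl⟩
    exact (csInf_le hb hmem).trans (hN θ)
  have h1 := (aux_main Ps hPsne hPsprob (A.indicator Lbar) (hLbarMeas.indicator hA)
    (fun θ => Set.indicator_nonneg (fun θ _ => hbar0 θ) θ) (max M 0) (fun θ => by
      by_cases h : θ ∈ A <;> simp [h, hM])).1
  have h2 := (aux_main Ps hPsne hPsprob (Aᶜ.indicator Llow) (hLlowMeas.indicator hA.compl)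
    (fun θ => Set.indicator_nonneg (fun θ _ => hlow0 θ) θ) (max N 0) (fun θ => by
      by_cases h : θ ∈ A <;> simp [h, hN])).2
  simp only [integral_indicator hA] at h1
  simp only [integral_indicator hA.compl] at h2
  have ha : 0 ≤ sSup {x : ℝ | ∃ P ∈ Ps, x = ∫ θ in A, Lbar θ ∂P} := by
    refine Real.sSup_nonneg ?_
    rintro x ⟨P, hP, rfl⟩
    exact integral_nonneg hbar0
  have hb : 0 ≤ ∫ t in Set.Ioi (0 : ℝ),
      sInf {x : ℝ | ∃ P ∈ Ps, x = (P {θ | Aᶜ.indicator Llow θ > t}).toReal} := by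
    refine integral_nonneg fun t => Real.sInf_nonneg ?_
    rintro x ⟨P, hP, rfl⟩
    exact ENNReal.toReal_nonneg
  rw [div_le_div_iff₀ hcpos hc'pos, hc, hc']
  have := mul_le_mul h1 h2 hb (ha.trans h1)
  linarith
end

section
/- Fix a measurable set A ⊆ Θ, a single bounded, nonnegative, measurable likelihood L on Θ, and a prior P ∈ 𝒫 with ∫_Θ L dP > 0. Let c := sup_{P'∈𝒫} ∫_A L dP' + inf_{P'∈𝒫} ∫_{Aᶜ} L dP', and assume c > 0. Then the posterior probability of A satisfies (∫_A L dP) / (∫_Θ L dP) ≤ (sup_{P'∈𝒫} ∫_A L dP') / c. (This is Wasserman and Kadane's Bayes' theorem for upper probabilities, recovered when the likelihood class is a singleton.) -/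
open MeasureTheory

/-- Wasserman and Kadane's Bayes' theorem for upper probabilities (singleton
likelihood class): for a single bounded nonnegative measurable likelihood `L` and any
prior `P ∈ Ps` with `∫_Θ L dP > 0`,
`(∫_A L dP)/(∫_Θ L dP) ≤ (sup_{P'∈Ps} ∫_A L dP') / c`, where
`c = sup_{P'∈Ps} ∫_A L dP' + inf_{P'∈Ps} ∫_{Aᶜ} L dP' > 0`. -/
theorem wasserman_kadane_posterior_upper_bound
    {Θ : Type*} [MeasurableSpace Θ]
    (Ps : Set (Measure Θ)) (hPsne : Ps.Nonempty)
    (hPsprob : ∀ P ∈ Ps, IsProbabilityMeasure P)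
    (L : Θ → ℝ) (hLmeas : Measurable L)
    (hLnonneg : ∀ θ, 0 ≤ L θ)
    (hLbdd : ∃ M : ℝ, ∀ θ, L θ ≤ M)
    (A : Set Θ) (hA : MeasurableSet A)
    (P : Measure Θ) (hP : P ∈ Ps)
    (hpos : 0 < ∫ θ, L θ ∂P)
    (c : ℝ)
    (hc : c = sSup {x : ℝ | ∃ P' ∈ Ps, x = ∫ θ in A, L θ ∂P'}
            + sInf {x : ℝ | ∃ P' ∈ Ps, x = ∫ θ in Aᶜ, L θ ∂P'})
    (hcpos : 0 < c) :
    (∫ θ in A, L θ ∂P) / (∫ θ, L θ ∂P)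
      ≤ sSup {x : ℝ | ∃ P' ∈ Ps, x = ∫ θ in A, L θ ∂P'} / c := by
  obtain ⟨M, hM⟩ := hLbdd
  have hint : ∀ P' ∈ Ps, Integrable L P' := by
    intro P' hP'
    haveI := hPsprob P' hP'
    refine Integrable.of_bound hLmeas.aestronglyMeasurable M (Filter.Eventually.of_forall ?_)
    intro θ
    rw [Real.norm_of_nonneg (hLnonneg θ)]
    exact hM θ
  have hbA : BddAbove {x : ℝ | ∃ P' ∈ Ps, x = ∫ θ in A, L θ ∂P'} := by
    refine ⟨M, ?_⟩
    rintro x ⟨P', hP', rfl⟩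
    haveI := hPsprob P' hP'
    calc ∫ θ in A, L θ ∂P' ≤ ∫ θ, L θ ∂P' :=
          setIntegral_le_integral (hint P' hP') (Filter.Eventually.of_forall hLnonneg)
      _ ≤ ∫ _, M ∂P' := integral_mono (hint P' hP') (integrable_const M) hM
      _ = M := by simp
  have hbB : BddBelow {x : ℝ | ∃ P' ∈ Ps, x = ∫ θ in Aᶜ, L θ ∂P'} := by
    refine ⟨0, ?_⟩
    rintro x ⟨P', hP', rfl⟩
    exact integral_nonneg hLnonneg
  have h1 := le_csSup hbA ⟨P, hP, rfl⟩
  have h2 := csInf_le hbB ⟨P, hP, rfl⟩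
  have h3 : 0 ≤ ∫ θ in A, L θ ∂P := integral_nonneg hLnonneg
  have h4 : 0 ≤ ∫ θ in Aᶜ, L θ ∂P := integral_nonneg hLnonneg
  have h5 := integral_add_compl hA (hint P hP)
  rw [div_le_div_iff₀ hpos hcpos, hc, ← h5]
  have h6 := mul_le_mul_of_nonneg_left h2 h3
  have h7 := mul_le_mul_of_nonneg_right h1 h4
  linarith
end
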